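/- Let G be a finitely generated virtually abelian group containing Z^n as a normal subgroup of finite index, let φ ∈ End(G) with φ(Z^n) ⊆ Z^n, and fix a finite set A ⊆ G of coset representatives of G/Z^n containing 1_G. Fix k ∈ ℕ_{>0} and let φ̄_k be the endomorphism induced by φ on G/(kZ)^n. Then for any a ∈ A and any x, y ∈ Z^n: the cosets (xa)(kZ)^n and (ya)(kZ)^n are φ̄_k-twisted conjugate in G/(kZ)^n if and only if x ∈ ⋃_{c ∈ E^a} ( τ_c(y) − (τ_a ∘ φ^a)(c) + ( Im(Id_{Z^n} − (τ_a ∘ φ)|_{Z^n}) + (kZ)^n ) ), where the arithmetic takes place in Z^n written additively. -/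

import Mathlib

open Filter Topology
open scoped Pointwise NNReal

/-- The rank of a subgroup `H` of `G`: the largest `n` such that the free abelian group
`ℤⁿ` embeds into `H`. For a finitely generated free abelian group this is its rank. -/
noncomputable def grpRank {G : Type*} [Group G] (H : Subgroup G) : ℕ :=
  sSup {n : ℕ | ∃ f : Multiplicative (Fin n → ℤ) →* G, Function.Injective f ∧ ∀ v, f v ∈ H}

/-- The image of the endomorphism `Id_N - (τ_g ∘ φ)|_N` of `N`, written multiplicatively:
the subgroup generated by `{x * (g * φ x * g⁻¹)⁻¹ : x ∈ N}` (this set is already a subgroup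
when `N` is abelian, normal and `φ`-invariant). -/
def twistImage {G : Type*} [Group G] (φ : G →* G) (N : Subgroup G) (g : G) : Subgroup G :=
  Subgroup.closure {y | ∃ x ∈ N, y = x * (g * φ x * g⁻¹)⁻¹}

/-- The minimum over the cosets `gN ∈ G/N` of `rank(Id_N - (τ_g ∘ φ)|_N)`. -/
noncomputable def minTwistRank {G : Type*} [Group G] (φ : G →* G) (N : Subgroup G) : ℕ :=
  sInf {m : ℕ | ∃ g : G, m = grpRank (twistImage φ N g)}

/-- The subgroup `kN` of `G` (corresponding to `(kℤ)ⁿ` when `N ≅ ℤⁿ`): the subgroup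
generated by the `k`-th powers of elements of `N`. -/
def powSubgroup {G : Type*} [Group G] (N : Subgroup G) (k : ℕ) : Subgroup G :=
  Subgroup.closure {y | ∃ x ∈ N, y = x ^ k}

/-- The twisted conjugacy quotient growth function: `f_Q(k)` is the Reidemeister number of the
endomorphism induced by `φ` on the quotient `G/kN`, counted as the number of equivalence classes
on `G` of the lifted twisted conjugacy relation. -/
noncomputable def fQ {G : Type*} [Group G] (φ : G →* G) (N : Subgroup G) (k : ℕ) : ℕ :=
  Nat.card {C : Set G | ∃ g : G,
    C = {x | ∃ z : G, (z * g * (φ z)⁻¹)⁻¹ * x ∈ powSubgroup N k}}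

/-- For `N` abelian, normal and `φ`-invariant, every element of `twistImage φ N g` is of the form
`x * (g * φ x * g⁻¹)⁻¹` with `x ∈ N`. -/
theorem mem_twistImage_iff {G : Type*} [Group G] {φ : G →* G} {N : Subgroup G} [N.Normal]
    (hcomm : ∀ x ∈ N, ∀ y ∈ N, x * y = y * x) (hφN : ∀ x ∈ N, φ x ∈ N) {g u : G} :
    u ∈ twistImage φ N g ↔ ∃ x ∈ N, u = x * (g * φ x * g⁻¹)⁻¹ := by
  have hconj : ∀ x ∈ N, g * φ x * g⁻¹ ∈ N := fun x hx =>
    Subgroup.Normal.conj_mem inferInstance _ (hφN x hx) g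
  refine ⟨fun hu => ?_, fun hu => Subgroup.subset_closure hu⟩
  induction hu using Subgroup.closure_induction with
  | mem v hv => exact hv
  | one => exact ⟨1, N.one_mem, by simp⟩
  | mul v w _ _ hv hw =>
    obtain ⟨p, hp, rfl⟩ := hv
    obtain ⟨q, hq, rfl⟩ := hw
    refine ⟨p * q, N.mul_mem hp hq, ?_⟩
    have h := hcomm _ (N.inv_mem (hconj p hp)) _ (N.mul_mem hq (N.inv_mem (hconj q hq)))
    rw [mul_assoc, h, map_mul]
    group
  | inv v _ hv =>
    obtain ⟨p, hp, rfl⟩ := hv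
    refine ⟨p⁻¹, N.inv_mem hp, ?_⟩
    have h := hcomm _ (hconj p hp) _ (N.inv_mem hp)
    rw [mul_inv_rev, inv_inv, h, map_inv]
    group

theorem powSubgroup_le {G : Type*} [Group G] (N : Subgroup G) (k : ℕ) : powSubgroup N k ≤ N :=
  (Subgroup.closure_le N).2 fun _ ⟨_, hx, hy⟩ => hy ▸ N.pow_mem hx k

theorem powSubgroup_normal {G : Type*} [Group G] (N : Subgroup G) [N.Normal] (k : ℕ) :
    (powSubgroup N k).Normal := by
  refine ⟨fun v hv g => ?_⟩
  induction hv using Subgroup.closure_induction with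
  | mem v hv =>
    obtain ⟨x, hx, rfl⟩ := hv
    exact Subgroup.subset_closure
      ⟨g * x * g⁻¹, Subgroup.Normal.conj_mem inferInstance x hx g, conj_pow.symm⟩
  | one => simp
  | mul v w _ _ hv hw => simpa [mul_assoc] using Subgroup.mul_mem _ hv hw
  | inv v _ hv => simpa [mul_assoc] using Subgroup.inv_mem _ hv

/-- Twisted conjugation of `y * a` by `m * c`, for `m ∈ N` and `c` fixing the coset `a N`. -/
theorem twisted_conj_mul_eq {G : Type*} [Group G] {φ : G →* G} {N : Subgroup G} [N.Normal]
    (hcomm : ∀ x ∈ N, ∀ y ∈ N, x * y = y * x) {a c m y : G} (hm : m ∈ N) (hy : y ∈ N)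
    (hc : a⁻¹ * (c * a * (φ c)⁻¹) ∈ N) :
    m * c * (y * a) * (φ (m * c))⁻¹ =
      (c * y * c⁻¹) * (a * φ c * a⁻¹ * c⁻¹)⁻¹ * (m * (a * φ m * a⁻¹)⁻¹) * a := by
  have hcy : c * y * c⁻¹ ∈ N := Subgroup.Normal.conj_mem inferInstance y hy c
  have hca : (a * φ c * a⁻¹ * c⁻¹)⁻¹ ∈ N := by
    have h := Subgroup.Normal.conj_mem inferInstance _ hc a
    convert h using 1
    group
  have h := hcomm _ (N.mul_mem hcy hca) _ hm
  rw [← mul_assoc _ m, h, map_mul]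
  group

/-- **Twisted conjugacy in the finite quotient `G/(kℤ)ⁿ` inside a coset of `ℤⁿ`.** The cosets
`(xa)·(kℤ)ⁿ` and `(ya)·(kℤ)ⁿ` are twisted conjugate under the induced endomorphism iff the stated
membership holds; multiplicative notation is used for the arithmetic in `N ≅ ℤⁿ`. -/
theorem twisted_conjugacy_in_coset_quotient {G : Type*} [Group G] (hG : Group.FG G)
    (n : ℕ) (N : Subgroup G) (hNnorm : N.Normal) (hNfin : N.FiniteIndex)
    (e : N ≃* Multiplicative (Fin n → ℤ))
    (φ : G →* G) (hφN : ∀ x ∈ N, φ x ∈ N)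
    (A : Finset G) (hA1 : (1 : G) ∈ A)
    (hArep : ∀ g : G, ∃ a ∈ A, a⁻¹ * g ∈ N)
    (hAuniq : ∀ a ∈ A, ∀ b ∈ A, a⁻¹ * b ∈ N → a = b)
    (k : ℕ) (hk : 0 < k)
    (a : G) (ha : a ∈ A) (x y : G) (hx : x ∈ N) (hy : y ∈ N) :
    (∃ z : G, (z * (y * a) * (φ z)⁻¹)⁻¹ * (x * a) ∈ powSubgroup N k) ↔
      ∃ c ∈ A, a⁻¹ * (c * a * (φ c)⁻¹) ∈ N ∧
        ∃ u ∈ twistImage φ N a, ∃ w ∈ powSubgroup N k,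
          x = (c * y * c⁻¹) * (a * φ c * a⁻¹ * c⁻¹)⁻¹ * u * w := by
  have hcomm : ∀ p ∈ N, ∀ q ∈ N, p * q = q * p := fun p hp q hq =>
    congrArg Subtype.val (e.injective (by rw [map_mul, map_mul, mul_comm]) :
      (⟨p, hp⟩ * ⟨q, hq⟩ : N) = ⟨q, hq⟩ * ⟨p, hp⟩)
  have hpow := powSubgroup_normal N k
  constructor
  · rintro ⟨z, hz⟩
    obtain ⟨c, hcA, hcz⟩ := hArep z
    obtain ⟨m, hm, rfl⟩ : ∃ m ∈ N, z = m * c :=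
      ⟨z * c⁻¹, hNnorm.mem_comm hcz, by group⟩
    have hc : a⁻¹ * (c * a * (φ c)⁻¹) ∈ N := by
      have h := powSubgroup_le N k hz
      rw [← QuotientGroup.eq_one_iff] at h ⊢
      have h1 := (QuotientGroup.eq_one_iff m).2 hm
      have h2 := (QuotientGroup.eq_one_iff (φ m)).2 (hφN m hm)
      have h3 := (QuotientGroup.eq_one_iff x).2 hx
      have h4 := (QuotientGroup.eq_one_iff y).2 hy
      simp only [map_mul, QuotientGroup.mk_mul, QuotientGroup.mk_inv, h1, h2, h3, h4, one_mul]
        at h ⊢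
      rw [inv_mul_eq_one] at h ⊢
      exact h.symm
    refine ⟨c, hcA, hc, _, (mem_twistImage_iff hcomm hφN).2 ⟨m, hm, rfl⟩, _,
      hpow.conj_mem _ hz a, ?_⟩
    rw [twisted_conj_mul_eq hcomm hm hy hc]
    group
  · rintro ⟨c, -, hc, u, hu, w, hw, rfl⟩
    obtain ⟨m, hm, rfl⟩ := (mem_twistImage_iff hcomm hφN).1 hu
    refine ⟨m * c, ?_⟩
    rw [twisted_conj_mul_eq hcomm hm hy hc]
    convert hpow.conj_mem _ hw a⁻¹ using 1
    group
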